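/- arXiv:1807.05899 — 10 statements merged into one kernel-verified Lean document; each statement's English description precedes it below -/
import Mathlib

section
/- Let 𝒰 ⊆ ℝ² be an open set invariant under (x,y) ↦ (x,−y), and let α, β : 𝒰 → ℍ be real-differentiable functions satisfying α(x,−y) = α(x,y), β(x,−y) = −β(x,y), ∂α/∂x = ∂β/∂y and ∂α/∂y = −∂β/∂x on 𝒰. Write α = α₀ + α₁ i + α₂ j + α₃ k and β = β₀ + β₁ i + β₂ j + β₃ k with real-valued components. Then, viewing 𝒰 as a subset of ℂ, for each m ∈ {0,1,2,3} the function f_m : 𝒰 → ℂ defined by f_m(x+ιy) = α_m(x,y) + ι β_m(x,y) is holomorphic on 𝒰 and satisfies f_m(conj z) = conj(f_m(z)) for all z ∈ 𝒰. -/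
noncomputable section
open Complex

/-- The four real components of a quaternion. -/
def qcomp (q : Quaternion ℝ) : Fin 4 → ℝ := ![q.re, q.imI, q.imJ, q.imK]

/-- Each component map of `qcomp` as a continuous linear functional. -/
def qcompCLM (m : Fin 4) : Quaternion ℝ →L[ℝ] ℝ :=
  LinearMap.toContinuousLinearMap
    { toFun := fun q => qcomp q m
      map_add' := fun p q => by fin_cases m <;> simp [qcomp]
      map_smul' := fun r q => by fin_cases m <;> simp [qcomp] }

theorem qcompCLM_apply (m : Fin 4) (q : Quaternion ℝ) : qcompCLM m q = qcomp q m := rfl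

/-- A pair of real-differentiable functions satisfying the Cauchy-Riemann equations at a point
gives a complex-differentiable function there. -/
theorem differentiableAt_ofReal_add_I_mul {u v : ℝ × ℝ → ℝ} {u' v' : ℝ × ℝ →L[ℝ] ℝ} {z : ℂ}
    (hu : HasFDerivAt u u' (z.re, z.im)) (hv : HasFDerivAt v v' (z.re, z.im))
    (h₁ : u' (1, 0) = v' (0, 1)) (h₂ : u' (0, 1) = -v' (1, 0)) :
    DifferentiableAt ℂ (fun w : ℂ => (u (w.re, w.im) : ℂ) + I * (v (w.re, w.im) : ℂ)) z := by
  have hp : HasFDerivAt (fun w : ℂ => (w.re, w.im)) (reCLM.prod imCLM) z :=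
    (reCLM.prod imCLM).hasFDerivAt
  have hF := (ofRealCLM.hasFDerivAt.comp z (hu.comp z hp)).add
    ((ofRealCLM.hasFDerivAt.comp z (hv.comp z hp)).const_mul I)
  have hF' : HasFDerivAt (𝕜 := ℝ)
      (fun w : ℂ => (u (w.re, w.im) : ℂ) + I * (v (w.re, w.im) : ℂ)) _ z := hF
  refine differentiableAt_complex_iff_differentiableAt_real.2 ⟨hF'.differentiableAt, ?_⟩
  rw [hF'.fderiv]
  apply Complex.ext <;> simp [h₁, h₂]

/-- if `α, β : 𝒰 → ℍ` are real-differentiable, satisfy the stated symmetries and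
the Cauchy-Riemann equations, then for each `m` the function
`f_m(x+ιy) = α_m(x,y) + ι β_m(x,y)` is holomorphic on `𝒰` (viewed in `ℂ`) and satisfies
`f_m(conj z) = conj (f_m z)`. -/
theorem stmt_0 (𝒰 : Set (ℝ × ℝ)) (hopen : IsOpen 𝒰)
    (hsymdom : ∀ p ∈ 𝒰, (p.1, -p.2) ∈ 𝒰)
    (α β : ℝ × ℝ → Quaternion ℝ)
    (hα : ∀ p ∈ 𝒰, DifferentiableAt ℝ α p)
    (hβ : ∀ p ∈ 𝒰, DifferentiableAt ℝ β p)
    (hαsym : ∀ p ∈ 𝒰, α (p.1, -p.2) = α p)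
    (hβsym : ∀ p ∈ 𝒰, β (p.1, -p.2) = -β p)
    (hCR1 : ∀ p ∈ 𝒰, fderiv ℝ α p (1, 0) = fderiv ℝ β p (0, 1))
    (hCR2 : ∀ p ∈ 𝒰, fderiv ℝ α p (0, 1) = -(fderiv ℝ β p (1, 0))) :
    ∀ m : Fin 4,
      DifferentiableOn ℂ
        (fun z : ℂ => (qcomp (α (z.re, z.im)) m : ℂ)
          + Complex.I * (qcomp (β (z.re, z.im)) m : ℂ))
        {z : ℂ | (z.re, z.im) ∈ 𝒰} ∧
      ∀ z : ℂ, (z.re, z.im) ∈ 𝒰 →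
        ((qcomp (α (((starRingEnd ℂ) z).re, ((starRingEnd ℂ) z).im)) m : ℂ)
            + Complex.I * (qcomp (β (((starRingEnd ℂ) z).re, ((starRingEnd ℂ) z).im)) m : ℂ))
          = (starRingEnd ℂ) ((qcomp (α (z.re, z.im)) m : ℂ)
              + Complex.I * (qcomp (β (z.re, z.im)) m : ℂ)) := by
  intro m
  refine ⟨fun z hz => ?_, fun z hz => ?_⟩
  · refine (differentiableAt_ofReal_add_I_mul
      ((qcompCLM m).hasFDerivAt.comp (z.re, z.im) (hα _ hz).hasFDerivAt)
      ((qcompCLM m).hasFDerivAt.comp (z.re, z.im) (hβ _ hz).hasFDerivAt)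
      ?_ ?_).differentiableWithinAt
    · simp [hCR1 _ hz]
    · simp [hCR2 _ hz]
  · have hneg : qcomp (-β (z.re, z.im)) m = -qcomp (β (z.re, z.im)) m :=
      map_neg (qcompCLM m) _
    simp only [conj_re, conj_im, hαsym _ hz, hβsym _ hz, hneg]
    simp
end
end

section
/- For every v ∈ 𝕊, the set Z_v = {z ∈ ℂ⁴ : ρ_v(z) = 0} is a complex vector subspace of ℂ⁴ (in particular it is closed under multiplication by complex scalars, not merely real ones) and its complex dimension equals 2. -/
noncomputable section
open Complex MeasureTheory

/-- The quaternion `i`. -/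
def qi : Quaternion ℝ := ⟨0,1,0,0⟩
/-- The quaternion `j`. -/
def qj : Quaternion ℝ := ⟨0,0,1,0⟩
/-- The quaternion `k`. -/
def qk : Quaternion ℝ := ⟨0,0,0,1⟩

/-- `ρ_v : ℂ → ℍ`, `x + ιy ↦ x + vy`. -/
def rhoC (v : Quaternion ℝ) (z : ℂ) : Quaternion ℝ := (z.re : Quaternion ℝ) + z.im • v

/-- `ρ_v : ℂ⁴ → ℍ`, `(z₀,z₁,z₂,z₃) ↦ ρ_v(z₀) + ρ_v(z₁)i + ρ_v(z₂)j + ρ_v(z₃)k`. -/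
def rho4 (v : Quaternion ℝ) (z : Fin 4 → ℂ) : Quaternion ℝ :=
  rhoC v (z 0) + rhoC v (z 1) * qi + rhoC v (z 2) * qj + rhoC v (z 3) * qk

/-- The quadratic form `Φ(z) = z₀² + z₁² + z₂² + z₃²`. -/
def Phi (z : Fin 4 → ℂ) : ℂ := z 0 ^ 2 + z 1 ^ 2 + z 2 ^ 2 + z 3 ^ 2

theorem rhoC_add (v : Quaternion ℝ) (z w : ℂ) : rhoC v (z + w) = rhoC v z + rhoC v w := by
  simp only [rhoC, Complex.add_re, Complex.add_im, Quaternion.coe_add, add_smul]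
  abel

theorem rhoC_ofReal (v : Quaternion ℝ) (r : ℝ) : rhoC v (r : ℂ) = (r : Quaternion ℝ) := by
  simp [rhoC]

theorem rhoC_mul {v : Quaternion ℝ} (hv : v ^ 2 = -1) (z w : ℂ) :
    rhoC v (z * w) = rhoC v z * rhoC v w := by
  have hv' : v * v = -1 := by rw [← sq, hv]
  have hone (r : ℝ) : (r : Quaternion ℝ) = r • 1 := Algebra.algebraMap_eq_smul_one r
  simp only [rhoC, hone, Complex.mul_re, Complex.mul_im, mul_add, add_mul, smul_mul_smul_comm,
    one_mul, mul_one, hv']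
  module

theorem rho4_add (v : Quaternion ℝ) (z w : Fin 4 → ℂ) :
    rho4 v (z + w) = rho4 v z + rho4 v w := by
  simp only [rho4, Pi.add_apply, rhoC_add, add_mul]
  abel

theorem rho4_smul {v : Quaternion ℝ} (hv : v ^ 2 = -1) (c : ℂ) (z : Fin 4 → ℂ) :
    rho4 v (c • z) = rhoC v c * rho4 v z := by
  simp only [rho4, Pi.smul_apply, smul_eq_mul, rhoC_mul hv, mul_add, mul_assoc]

/-- `ρ_v : ℂ⁴ → ℍ` as a real-linear map. -/
def rho4Linear {v : Quaternion ℝ} (hv : v ^ 2 = -1) : (Fin 4 → ℂ) →ₗ[ℝ] Quaternion ℝ where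
  toFun := rho4 v
  map_add' := rho4_add v
  map_smul' r z := by
    rw [← Complex.coe_smul, rho4_smul hv, rhoC_ofReal, Quaternion.coe_mul_eq_smul, RingHom.id_apply]

theorem rho4_surjective (v : Quaternion ℝ) : Function.Surjective (rho4 v) := by
  intro q
  refine ⟨![(q.re : ℂ), (q.imI : ℂ), (q.imJ : ℂ), (q.imK : ℂ)], ?_⟩
  ext <;> simp [rho4, rhoC] <;> simp [qi, qj, qk]

/-- The zero set `Z_v` of `ρ_v` as a complex subspace of `ℂ⁴`. -/
def rho4Ker {v : Quaternion ℝ} (hv : v ^ 2 = -1) : Submodule ℂ (Fin 4 → ℂ) where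
  carrier := {z | rho4 v z = 0}
  add_mem' {z w} hz hw := by
    rw [Set.mem_ofPred_eq] at hz hw ⊢
    rw [rho4_add, hz, hw, add_zero]
  zero_mem' := (rho4Linear hv).map_zero
  smul_mem' c z hz := by
    rw [Set.mem_ofPred_eq] at hz ⊢
    rw [rho4_smul hv, hz, mul_zero]

theorem finrank_rho4Ker {v : Quaternion ℝ} (hv : v ^ 2 = -1) :
    Module.finrank ℂ (rho4Ker hv) = 2 := by
  have hker : Module.finrank ℝ (LinearMap.ker (rho4Linear hv)) =
      Module.finrank ℝ (rho4Ker hv) := rfl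
  have hrange : LinearMap.range (rho4Linear hv) = ⊤ :=
    LinearMap.range_eq_top.2 (rho4_surjective v)
  have hsum := LinearMap.finrank_range_add_finrank_ker (rho4Linear hv)
  rw [hrange, finrank_top, Quaternion.finrank_eq_four, hker, finrank_real_of_complex,
    finrank_real_of_complex, Module.finrank_fin_fun] at hsum
  omega

/-- for every imaginary unit `v`, `Z_v = {z ∈ ℂ⁴ : ρ_v(z) = 0}` is a complex
vector subspace of `ℂ⁴` of complex dimension `2`. -/
theorem stmt_1 (v : Quaternion ℝ) (hv : v ^ 2 = -1) :
    ∃ W : Submodule ℂ (Fin 4 → ℂ),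
      (W : Set (Fin 4 → ℂ)) = {z : Fin 4 → ℂ | rho4 v z = 0} ∧
      Module.finrank ℂ W = 2 :=
  ⟨rho4Ker hv, rfl, finrank_rho4Ker hv⟩
end
end

section
/- For every z = (z₀,z₁,z₂,z₃) ∈ ℂ⁴, there exists v ∈ 𝕊 with ρ_v(z) = 0 if and only if z₀² + z₁² + z₂² + z₃² = 0. In other words, the set Z = {z ∈ ℂ⁴ : ∃ v ∈ 𝕊, ρ_v(z) = 0} is exactly the zero locus of the quadratic form Φ. -/
noncomputable section
open Complex MeasureTheory

attribute [simps] qi qj qk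

/-- The quaternion with coordinates the real parts of a vector in `ℂ⁴`. -/
@[simps]
def quaternionRe (z : Fin 4 → ℂ) : Quaternion ℝ := ⟨(z 0).re, (z 1).re, (z 2).re, (z 3).re⟩

/-- The quaternion with coordinates the imaginary parts of a vector in `ℂ⁴`. -/
@[simps]
def quaternionIm (z : Fin 4 → ℂ) : Quaternion ℝ := ⟨(z 0).im, (z 1).im, (z 2).im, (z 3).im⟩

theorem rho4_eq_quaternionRe_add_mul (v : Quaternion ℝ) (z : Fin 4 → ℂ) :
    rho4 v z = quaternionRe z + v * quaternionIm z := by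
  ext <;> simp [rho4, rhoC] <;> ring

theorem Phi_eq_zero_iff (z : Fin 4 → ℂ) :
    Phi z = 0 ↔ Quaternion.normSq (quaternionRe z) = Quaternion.normSq (quaternionIm z) ∧
      (quaternionRe z * star (quaternionIm z)).re = 0 := by
  simp [Phi, Complex.ext_iff, Quaternion.normSq_def', pow_two]
  constructor <;> rintro ⟨h₁, h₂⟩ <;> constructor <;> linarith

theorem Quaternion.sq_eq_neg_one_iff (v : Quaternion ℝ) :
    v ^ 2 = -1 ↔ Quaternion.normSq v = 1 ∧ v.re = 0 := by
  constructor
  · intro h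
    have hn : Quaternion.normSq v = 1 := by
      have h' := congrArg Quaternion.normSq h
      rw [map_pow, Quaternion.normSq_neg, map_one] at h'
      exact (pow_eq_one_iff_of_nonneg Quaternion.normSq_nonneg two_ne_zero).1 h'
    refine ⟨hn, Quaternion.sq_eq_neg_normSq.1 ?_⟩
    rw [h, hn, Quaternion.coe_one]
  · rintro ⟨hn, hr⟩
    rw [Quaternion.sq_eq_neg_normSq.2 hr, hn, Quaternion.coe_one]

/-- `z ∈ ℂ⁴` admits an imaginary unit `v` with `ρ_v(z) = 0` if and only if
`Φ(z) = z₀² + z₁² + z₂² + z₃² = 0`. -/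
theorem stmt_2 (z : Fin 4 → ℂ) :
    (∃ v : Quaternion ℝ, v ^ 2 = -1 ∧ rho4 v z = 0) ↔ Phi z = 0 := by
  simp only [rho4_eq_quaternionRe_add_mul, Phi_eq_zero_iff, Quaternion.sq_eq_neg_one_iff]
  generalize quaternionRe z = a
  generalize quaternionIm z = b
  constructor
  · rintro ⟨v, ⟨hn, hr⟩, h⟩
    obtain rfl : a = -(v * b) := eq_neg_of_add_eq_zero_left h
    constructor
    · rw [Quaternion.normSq_neg, map_mul, hn, one_mul]
    · rw [neg_mul, mul_assoc, Quaternion.self_mul_star, Quaternion.mul_coe_eq_smul]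
      simp [hr]
  · rintro ⟨hn, hr⟩
    rcases eq_or_ne b 0 with rfl | hb
    · obtain rfl : a = 0 := by simpa using hn
      exact ⟨qi, by simp [Quaternion.normSq_def'], by simp⟩
    · refine ⟨-(a * b⁻¹), ⟨?_, ?_⟩, ?_⟩
      · rw [Quaternion.normSq_neg, map_mul, Quaternion.normSq_inv, hn,
          mul_inv_cancel₀ (Quaternion.normSq_ne_zero.2 hb)]
      · rw [Quaternion.re_neg, Quaternion.inv_def, mul_smul_comm, Quaternion.re_smul, hr,
          smul_zero, neg_zero]
      · rw [neg_mul, mul_assoc, inv_mul_cancel₀ hb, mul_one, add_neg_cancel]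
end
end

section
/- Let v, w ∈ 𝕊 with v ≠ w. If z ∈ ℂ⁴ satisfies ρ_v(z) = 0 and ρ_w(z) = 0, then z = 0. Equivalently, the planes Z_v = {z ∈ ℂ⁴ : ρ_v(z) = 0} for distinct imaginary units intersect only at the origin. -/
noncomputable section
open Complex MeasureTheory

lemma qi_components : qi.re = 0 ∧ qi.imI = 1 ∧ qi.imJ = 0 ∧ qi.imK = 0 :=
  ⟨rfl, rfl, rfl, rfl⟩

lemma qj_components : qj.re = 0 ∧ qj.imI = 0 ∧ qj.imJ = 1 ∧ qj.imK = 0 :=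
  ⟨rfl, rfl, rfl, rfl⟩

lemma qk_components : qk.re = 0 ∧ qk.imI = 0 ∧ qk.imJ = 0 ∧ qk.imK = 1 :=
  ⟨rfl, rfl, rfl, rfl⟩

lemma equivTuple_symm_components (a : Fin 4 → ℝ) :
    ((Quaternion.equivTuple ℝ).symm a).re = a 0 ∧ ((Quaternion.equivTuple ℝ).symm a).imI = a 1 ∧
    ((Quaternion.equivTuple ℝ).symm a).imJ = a 2 ∧ ((Quaternion.equivTuple ℝ).symm a).imK = a 3 :=
  ⟨rfl, rfl, rfl, rfl⟩

/-- `ρ_v(z) = Re z + v * Im z`, where `Re z` and `Im z` are the quaternions of componentwise real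
and imaginary parts. -/
lemma rho4_eq_add_mul (v : Quaternion ℝ) (z : Fin 4 → ℂ) :
    rho4 v z = (Quaternion.equivTuple ℝ).symm (fun n ↦ (z n).re) +
      v * (Quaternion.equivTuple ℝ).symm (fun n ↦ (z n).im) := by
  ext <;> simp [rho4, rhoC, qi_components, qj_components, qk_components,
    equivTuple_symm_components, -Quaternion.equivTuple_symm_apply] <;> ring

/-- if `v ≠ w` are imaginary units and `ρ_v(z) = ρ_w(z) = 0`, then `z = 0`;
i.e. the planes `Z_v` for distinct imaginary units intersect only at the origin. -/
theorem stmt_3 (v w : Quaternion ℝ) (hv : v ^ 2 = -1) (hw : w ^ 2 = -1) (hvw : v ≠ w)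
    (z : Fin 4 → ℂ) (hzv : rho4 v z = 0) (hzw : rho4 w z = 0) : z = 0 := by
  rw [rho4_eq_add_mul] at hzv hzw
  have h_zero : (Quaternion.equivTuple ℝ).symm 0 = 0 := rfl
  have him : (Quaternion.equivTuple ℝ).symm (fun n ↦ (z n).im) = 0 := by
    refine (mul_eq_zero.mp ?_).resolve_left (sub_ne_zero.mpr hvw)
    rw [sub_mul, sub_eq_zero]
    exact add_left_cancel (hzv.trans hzw.symm)
  rw [him, mul_zero, add_zero] at hzv
  have hre' := (Quaternion.equivTuple ℝ).symm.injective (hzv.trans h_zero.symm)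
  have him' := (Quaternion.equivTuple ℝ).symm.injective (him.trans h_zero.symm)
  exact funext fun n ↦ Complex.ext (congrFun hre' n) (congrFun him' n)
end
end

section
/- Let q = q₀ + q₁ i + q₂ j + q₃ k ∈ ℍ and set Z(q) = {z ∈ ℂ⁴ : (z₀−q₀)² + (z₁−q₁)² + (z₂−q₂)² + (z₃−q₃)² = 0}. Then for every basepoint p ∈ ℂ⁴ ∖ Z(q), the fundamental group of ℂ⁴ ∖ Z(q) at p is isomorphic (as a group) to ℤ. -/
noncomputable section
open Complex

/-! ### Punctured real vector spaces are simply connected -/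

/-- The complement of the closed ray spanned by `-v` is star-shaped about `v`. -/
theorem starConvex_compl_neg_ray {E : Type*} [AddCommGroup E] [Module ℝ E] {v : E} (hv : v ≠ 0) :
    StarConvex ℝ v {y : E | ∀ c : ℝ, 0 ≤ c → y + c • v ≠ 0} := by
  intro y hy a b ha hb hab c hc h
  rcases hb.eq_or_lt with rfl | hb
  · obtain rfl : a = 1 := by linarith
    rw [zero_smul, add_zero, ← add_smul, smul_eq_zero] at h
    exact h.elim (fun h ↦ by linarith) hv
  · refine hy ((a + c) / b) (by positivity) ?_
    have hy' : y + ((a + c) / b) • v = b⁻¹ • (a • v + b • y + c • v) := by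
      match_scalars <;> field_simp
    rw [hy', h, smul_zero]

/-- A `C¹` loop avoiding the origin of a real vector space of dimension at least three is
contractible in the complement of the origin. -/
theorem exists_homotopy_refl_of_contDiff {E : Type*} [NormedAddCommGroup E] [NormedSpace ℝ E]
    [FiniteDimensional ℝ E] (hE : 2 < Module.finrank ℝ E) {x : E} (p : Path x x) {g : ℝ → E}
    (hg : ContDiff ℝ 1 g) (hpg : ∀ t, p t = g t) (hp : ∀ t, p t ≠ 0) :
    ∃ F : p.Homotopy (.refl x), ∀ t, F t ≠ 0 := by
  have hdense : Dense (Set.range fun st : ℝ × ℝ ↦ st.1 • g st.2)ᶜ :=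
    ContDiff.dense_compl_range_of_finrank_lt_finrank (by fun_prop) (by simpa using hE)
  obtain ⟨v, hv⟩ := hdense.nonempty
  have hv0 : v ≠ 0 := by
    rintro rfl
    exact hv ⟨(0, 0), by simp⟩
  have hstar := starConvex_compl_neg_ray hv0
  have hp' : ∀ t, p t ∈ {y : E | ∀ c : ℝ, 0 ≤ c → y + c • v ≠ 0} := by
    intro t c hc h
    rcases hc.eq_or_lt with rfl | hc
    · exact hp t (by simpa using h)
    · refine hv ⟨(-c⁻¹, t), ?_⟩
      simp only
      rw [← hpg, eq_neg_of_add_eq_zero_left h, smul_neg, neg_smul, neg_neg, smul_smul,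
        inv_mul_cancel₀ hc.ne', one_smul]
  have := hstar.contractibleSpace ⟨_, hp' 0⟩
  obtain ⟨F, hF⟩ := (isSimplyConnected_iff_exists_homotopy_refl_forall_mem.1
    (inferInstanceAs (SimplyConnectedSpace {y : E | ∀ c : ℝ, 0 ≤ c → y + c • v ≠ 0}))).2 x p hp'
  exact ⟨F, fun t ↦ by simpa using hF t 0 le_rfl⟩

/-- A path avoiding the origin can be deformed, relative to its endpoints and away from the origin,
to a `C¹` path. -/
theorem exists_homotopy_contDiff {E : Type*} [NormedAddCommGroup E] [NormedSpace ℝ E]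
    {x y : E} (p : Path x y) (hp : ∀ t, p t ≠ 0) :
    ∃ (q : Path x y) (g : ℝ → E), ContDiff ℝ 1 g ∧ (∀ t, q t = g t) ∧
      ∃ F : p.Homotopy q, ∀ t, F t ≠ 0 := by
  obtain ⟨t₀, -, ht₀⟩ := isCompact_univ.exists_isMinOn Set.univ_nonempty
    (show Continuous fun t ↦ ‖p t‖ by fun_prop).continuousOn
  set ε := ‖p t₀‖ / 2 with hε
  have hε0 : 0 < ε := by have := norm_pos_iff.2 (hp t₀); positivity
  obtain ⟨f, hf, hfp, -⟩ := p.continuous_extend.exists_contDiff_approx (ε := fun _ ↦ ε) 1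
    continuous_const fun _ ↦ hε0
  replace hfp (t : ℝ) : ‖p.extend t - f t‖ < ε := by simpa [dist_eq_norm, norm_sub_rev] using hfp t
  have hf0 : ‖x - f 0‖ < ε := by simpa using hfp 0
  have hf1 : ‖y - f 1‖ < ε := by simpa using hfp 1
  let g (t : ℝ) : E := f t + ((1 - t) • (x - f 0) + t • (y - f 1))
  have hg : ContDiff ℝ 1 g := by
    have hf : ContDiff ℝ 1 f := mod_cast hf
    fun_prop
  have hgp (t : unitInterval) : ‖g t - p t‖ < ‖p t‖ := by
    have ht : ‖p.extend t - f t‖ < ε := hfp t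
    rw [p.extend_apply t.2] at ht
    have h0 := t.2.1
    have h1 := sub_nonneg.2 t.2.2
    have hcorr : ‖(1 - (t : ℝ)) • (x - f 0) + (t : ℝ) • (y - f 1)‖ ≤ ε := by
      refine (norm_add_le _ _).trans ?_
      rw [norm_smul_of_nonneg h1, norm_smul_of_nonneg h0]
      nlinarith
    have htri : ‖g t - p t‖ ≤
        ‖(1 - (t : ℝ)) • (x - f 0) + (t : ℝ) • (y - f 1)‖ + ‖p t - f t‖ := by
      refine le_trans (le_of_eq ?_) (norm_sub_le _ _)
      congr 1
      simp only [g]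
      abel
    have : ‖p t₀‖ ≤ ‖p t‖ := ht₀ (Set.mem_univ t)
    have ht' : ‖p t - f t‖ < ε := ht
    linarith
  let q : Path x y := ⟨⟨fun t ↦ g t, hg.continuous.comp continuous_subtype_val⟩,
    by simp [g], by simp [g]⟩
  have hq (t : unitInterval) : q t = g t := rfl
  refine ⟨q, g, hg, hq, ⟨ContinuousMap.Homotopy.affine p.toContinuousMap q.toContinuousMap, ?_⟩, ?_⟩
  · rintro s t (rfl | rfl) <;> simp
  · rintro ⟨s, t⟩ h
    have h' : p t + (s : ℝ) • (g t - p t) = 0 := by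
      rw [← hq, add_comm]
      exact h
    have hs : ‖(s : ℝ) • (g t - p t)‖ ≤ ‖g t - p t‖ := by
      rw [norm_smul_of_nonneg s.2.1]
      exact mul_le_of_le_one_left (norm_nonneg _) s.2.2
    rw [eq_neg_of_add_eq_zero_right h', norm_neg] at hs
    exact (hs.trans_lt (hgp t)).false

/-- The complement of the origin in a real vector space of dimension at least three is simply
connected. -/
theorem isSimplyConnected_compl_zero {E : Type*} [NormedAddCommGroup E] [NormedSpace ℝ E]
    [FiniteDimensional ℝ E] (hE : 2 < Module.finrank ℝ E) : IsSimplyConnected ({0}ᶜ : Set E) := by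
  refine isSimplyConnected_iff_exists_homotopy_refl_forall_mem.2
    ⟨isPathConnected_compl_singleton_of_one_lt_rank ?_ 0, fun x p hp ↦ ?_⟩
  · rw [← Module.finrank_eq_rank]
    exact_mod_cast (by omega : 1 < Module.finrank ℝ E)
  · obtain ⟨q, g, hg, hqg, F, hF⟩ := exists_homotopy_contDiff p hp
    obtain ⟨G, hG⟩ := exists_homotopy_refl_of_contDiff hE q hg hqg
      fun t ↦ by simpa using hF (1, t)
    refine ⟨F.trans G, fun t ↦ ?_⟩
    rw [Path.Homotopy.trans_apply]
    split_ifs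
    exacts [hF _, hG _]

/-! ### Fundamental groups -/

section FundamentalGroup

variable {X Y : Type*} [TopologicalSpace X] [TopologicalSpace Y]

/-- Homotopy equivalent spaces have isomorphic fundamental groups. -/
def ContinuousMap.HomotopyEquiv.fundamentalGroupMulEquiv (e : ContinuousMap.HomotopyEquiv X Y)
    (x : X) : FundamentalGroup X x ≃* FundamentalGroup Y (e x) :=
  (FundamentalGroupoidFunctor.equivOfHomotopyEquiv e).fullyFaithfulFunctor.mulEquivEnd ⟨x⟩

/-- Taking the product with a simply connected space does not change the fundamental group. -/
def FundamentalGroup.prodSimplyConnectedMulEquiv [SimplyConnectedSpace X] (z : X × Y) :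
    FundamentalGroup (X × Y) z ≃* FundamentalGroup Y z.2 :=
  MulEquiv.ofBijective (FundamentalGroup.map ⟨Prod.snd, continuous_snd⟩ z) <| by
    constructor
    · intro a b h
      change Path.Homotopic.projRight a = Path.Homotopic.projRight b at h
      rw [← Path.Homotopic.prod_projLeft_projRight a, ← Path.Homotopic.prod_projLeft_projRight b, h,
        Subsingleton.elim (Path.Homotopic.projLeft a) (Path.Homotopic.projLeft b)]
    · intro b
      exact ⟨Path.Homotopic.prod (.refl z.1) b, Path.Homotopic.projRight_prod _ _⟩

/-- The fundamental group of the punctured complex plane is infinite cyclic. -/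
theorem nonempty_fundamentalGroup_punctured_plane_mulEquiv (z : {z : ℂ // z ≠ 0}) :
    Nonempty (FundamentalGroup {z : ℂ // z ≠ 0} z ≃* Multiplicative ℤ) := by
  have hinj : Function.Injective fun n : ℤ ↦ n • (2 * Real.pi * I) := fun m n h ↦ by
    simpa [Real.pi_ne_zero] using h
  exact ⟨(isAddQuotientCoveringMap_exp.fundamentalGroupEquiv
    ⟨log z, Subtype.ext (exp_log z.2)⟩).trans <|
    (MulOpposite.opMulEquiv (M := Multiplicative _)).symm.trans <|
    (AddEquiv.toMultiplicative <| .symm <| AddEquiv.ofBijective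
      ((zmultiplesHom ℂ (2 * Real.pi * I)).rangeRestrict)
      ⟨fun m n h ↦ hinj (congrArg Subtype.val h), AddMonoidHom.rangeRestrict_surjective _⟩)⟩

end FundamentalGroup

/-! ### The complement of the quadric -/

open scoped ComplexConjugate

theorem mul_conj_add_mul_conj_ne_zero {u : ℂ × ℂ} (hu : u ≠ 0) :
    u.1 * conj u.1 + u.2 * conj u.2 ≠ 0 := by
  rw [mul_conj, mul_conj]
  norm_cast
  intro h
  have h1 := normSq_nonneg u.1
  have h2 := normSq_nonneg u.2
  exact hu (Prod.ext (normSq_eq_zero.1 (by linarith)) (normSq_eq_zero.1 (by linarith)))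

/-- A pair of linearly independent vectors `(a, b)`, `(c, d)` of `ℂ²` is determined by the nonzero
vector `(a, b)` together with the coefficients `m` and `l ≠ 0` of
`(c, d) = m (a, b) + l (-b̄, ā)`. -/
def detNeZeroHomeomorph :
    {w : (ℂ × ℂ) × ℂ × ℂ // w.1.1 * w.2.2 - w.1.2 * w.2.1 ≠ 0} ≃ₜ
      ({0}ᶜ : Set (ℂ × ℂ)) × ℂ × {z : ℂ // z ≠ 0} where
  toFun w :=
    have hw : w.1.1 ≠ 0 := fun h ↦ w.2 (by simp [h])
    (⟨w.1.1, hw⟩,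
      (w.1.2.1 * conj w.1.1.1 + w.1.2.2 * conj w.1.1.2) /
        (w.1.1.1 * conj w.1.1.1 + w.1.1.2 * conj w.1.1.2),
      ⟨(w.1.1.1 * w.1.2.2 - w.1.1.2 * w.1.2.1) /
        (w.1.1.1 * conj w.1.1.1 + w.1.1.2 * conj w.1.1.2),
        div_ne_zero w.2 (mul_conj_add_mul_conj_ne_zero hw)⟩)
  invFun y :=
    ⟨(y.1.1, y.2.1 * y.1.1.1 - y.2.2.1 * conj y.1.1.2, y.2.1 * y.1.1.2 + y.2.2.1 * conj y.1.1.1), by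
      have h := mul_ne_zero y.2.2.2 (mul_conj_add_mul_conj_ne_zero y.1.2)
      refine fun h' ↦ h ?_
      linear_combination h'⟩
  left_inv := by
    rintro ⟨⟨⟨a, b⟩, c, d⟩, hw⟩
    have h := mul_conj_add_mul_conj_ne_zero (u := (a, b)) fun h ↦ hw <| by
      obtain ⟨rfl, rfl⟩ := Prod.mk_eq_zero.1 h
      simp
    ext
    · rfl
    · rfl
    · simp only at h ⊢
      generalize hN : a * conj a + b * conj b = N at h ⊢
      field_simp
      rw [← hN]
      ring
    · simp only at h ⊢
      generalize hN : a * conj a + b * conj b = N at h ⊢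
      field_simp
      rw [← hN]
      ring
  right_inv := by
    rintro ⟨⟨⟨a, b⟩, hu⟩, m, l, hl⟩
    have h := mul_conj_add_mul_conj_ne_zero hu
    ext
    · rfl
    · rfl
    · simp only at h ⊢
      generalize hN : a * conj a + b * conj b = N at h ⊢
      field_simp
      rw [← hN]
      ring
    · simp only at h ⊢
      generalize hN : a * conj a + b * conj b = N at h ⊢
      field_simp
      rw [← hN]
      ring
  continuous_toFun := by
    have h (w : {w : (ℂ × ℂ) × ℂ × ℂ // w.1.1 * w.2.2 - w.1.2 * w.2.1 ≠ 0}) :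
        w.1.1.1 * conj w.1.1.1 + w.1.1.2 * conj w.1.1.2 ≠ 0 :=
      mul_conj_add_mul_conj_ne_zero fun h ↦ w.2 (by simp [h])
    refine .prodMk (by fun_prop) (.prodMk ?_ (.subtype_mk ?_ _)) <;>
      exact .div (by fun_prop) (by fun_prop) h
  continuous_invFun := by fun_prop

/-- Affine coordinates in which the sum of four squares centred at `q` becomes a determinant. -/
def sumSqCoordinates (q : Fin 4 → ℂ) : (Fin 4 → ℂ) ≃ₜ (ℂ × ℂ) × ℂ × ℂ where
  toFun z := (((z 0 - q 0) + (z 1 - q 1) * I, (z 2 - q 2) + (z 3 - q 3) * I),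
    -(z 2 - q 2) + (z 3 - q 3) * I, (z 0 - q 0) - (z 1 - q 1) * I)
  invFun w := ![q 0 + (w.1.1 + w.2.2) / 2, q 1 + (w.2.2 - w.1.1) / 2 * I,
    q 2 + (w.1.2 - w.2.1) / 2, q 3 - (w.1.2 + w.2.1) / 2 * I]
  left_inv z := by
    funext i
    fin_cases i <;> simp <;> ring_nf <;> simp
  right_inv := by
    rintro ⟨⟨a, b⟩, c, d⟩
    ext1 <;> ext1 <;> simp <;> ring_nf <;> simp <;> ring
  continuous_toFun := by fun_prop
  continuous_invFun := by
    refine continuous_pi fun i ↦ ?_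
    fin_cases i <;> simp <;> fun_prop

theorem det_sumSqCoordinates (q z : Fin 4 → ℂ) :
    (sumSqCoordinates q z).1.1 * (sumSqCoordinates q z).2.2 -
        (sumSqCoordinates q z).1.2 * (sumSqCoordinates q z).2.1 =
      (z 0 - q 0) ^ 2 + (z 1 - q 1) ^ 2 + (z 2 - q 2) ^ 2 + (z 3 - q 3) ^ 2 := by
  simp only [sumSqCoordinates, Homeomorph.homeomorph_mk_coe, Equiv.coe_fn_mk]
  linear_combination (-(z 1 - q 1) ^ 2 - (z 3 - q 3) ^ 2) * I_sq

/-- for `q ∈ ℍ` and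
`Z(q) = {z ∈ ℂ⁴ : (z₀−q₀)² + (z₁−q₁)² + (z₂−q₂)² + (z₃−q₃)² = 0}`, the fundamental group
of `ℂ⁴ ∖ Z(q)` at any basepoint `p` is isomorphic to `ℤ`. -/
theorem stmt_4 (q : Quaternion ℝ) (Zq : Set (Fin 4 → ℂ))
    (hZq : Zq = {z : Fin 4 → ℂ |
      (z 0 - (q.re : ℂ)) ^ 2 + (z 1 - (q.imI : ℂ)) ^ 2
        + (z 2 - (q.imJ : ℂ)) ^ 2 + (z 3 - (q.imK : ℂ)) ^ 2 = 0})
    (p : Fin 4 → ℂ) (hp : p ∈ Zqᶜ) :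
    Nonempty (FundamentalGroup (↥(Zqᶜ)) ⟨p, hp⟩ ≃* Multiplicative ℤ) := by
  have : SimplyConnectedSpace ({0}ᶜ : Set (ℂ × ℂ)) :=
    isSimplyConnected_compl_zero (by simp [finrank_real_complex])
  let e : (Zqᶜ : Set (Fin 4 → ℂ)) ≃ₜ ({0}ᶜ : Set (ℂ × ℂ)) × ℂ × {z : ℂ // z ≠ 0} :=
    ((sumSqCoordinates ![q.re, q.imI, q.imJ, q.imK]).subtype fun z ↦ by
      rw [det_sumSqCoordinates, hZq]
      simp).trans detNeZeroHomeomorph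
  obtain ⟨f⟩ := nonempty_fundamentalGroup_punctured_plane_mulEquiv (e ⟨p, hp⟩).2.2
  exact ⟨(e.toHomotopyEquiv.fundamentalGroupMulEquiv ⟨p, hp⟩).trans <|
    (FundamentalGroup.prodSimplyConnectedMulEquiv _).trans <|
    (FundamentalGroup.prodSimplyConnectedMulEquiv _).trans f⟩
end
end

section
/- With 𝒰 and F as in the context, assume 𝒰 is connected and let x₀ ∈ 𝒰 ∩ ℝ. Suppose that, for some integer k ≥ 1, there is a holomorphic map G : 𝒰 → ℂ⁴ with F(z) = (z − x₀)^k · G(z) for all z ∈ 𝒰 and G(x₀) ≠ 0 (i.e. the real zero x₀ of f has multiplicity k). Then the holomorphic function Φ∘F has a zero of order exactly 2k at x₀: there is a holomorphic function h near x₀ with Φ(F(z)) = (z − x₀)^{2k} h(z) and h(x₀) ≠ 0. -/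
noncomputable section
open Complex MeasureTheory

/-- `Φ` is anisotropic on vectors with real coordinates. -/
theorem Phi_ne_zero_of_im_eq_zero {w : Fin 4 → ℂ} (him : ∀ m, (w m).im = 0) (hw : w ≠ 0) :
    Phi w ≠ 0 := by
  intro h
  have hre := congrArg Complex.re h
  simp only [Phi, pow_two, Complex.add_re, Complex.mul_re, him, Complex.zero_re] at hre
  apply hw
  funext m
  refine Complex.ext ?_ (him m)
  fin_cases m <;>
    exact pow_eq_zero_iff two_ne_zero |>.mp (by
      dsimp only [Fin.zero_eta, Fin.mk_one, Fin.reduceFinMk]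
      nlinarith [sq_nonneg (w 0).re, sq_nonneg (w 1).re, sq_nonneg (w 2).re, sq_nonneg (w 3).re])

/-- If `(x - x₀) ^ k * g x` is real for all real `x` near `x₀` and `g` is continuous at `x₀`,
then `g x₀` is real. -/
theorem im_eq_zero_of_eventually_im_pow_mul_eq_zero {g : ℂ → ℂ} {x₀ : ℝ} (k : ℕ)
    (hg : ContinuousAt g (x₀ : ℂ))
    (h : ∀ᶠ x : ℝ in nhds x₀, (((x : ℂ) - (x₀ : ℂ)) ^ k * g x).im = 0) :
    (g (x₀ : ℂ)).im = 0 := by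
  have hcont : ContinuousAt (fun x : ℝ => (g (x : ℂ)).im) x₀ :=
    Complex.continuous_im.continuousAt.comp
      (ContinuousAt.comp (f := fun x : ℝ => (x : ℂ)) hg Complex.continuous_ofReal.continuousAt)
  refine tendsto_nhds_unique (hcont.tendsto.mono_left nhdsWithin_le_nhds)
    (tendsto_const_nhds.congr' (f₁ := fun _ => (0 : ℝ)) (l₁ := nhdsWithin x₀ {x₀}ᶜ) ?_)
  filter_upwards [h.filter_mono nhdsWithin_le_nhds, self_mem_nhdsWithin] with x hx hne
  rw [← Complex.ofReal_sub, ← Complex.ofReal_pow, Complex.im_ofReal_mul] at hx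
  exact ((mul_eq_zero.mp hx).resolve_left (pow_ne_zero k (sub_ne_zero.mpr hne))).symm

/-- if the real point `x₀` is a zero of multiplicity `k` of `f`
(i.e. `F(z) = (z−x₀)^k • G(z)` with `G` holomorphic and `G(x₀) ≠ 0`), then `Φ∘F` has a zero
of order exactly `2k` at `x₀`. -/
theorem stmt_7 (𝒰 : Set ℂ) (hopen : IsOpen 𝒰) (hconn : IsConnected 𝒰)
    (hsym : ∀ z ∈ 𝒰, (starRingEnd ℂ) z ∈ 𝒰)
    (F : ℂ → Fin 4 → ℂ) (hF : DifferentiableOn ℂ F 𝒰)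
    (hFsym : ∀ z ∈ 𝒰, F ((starRingEnd ℂ) z) = fun m => (starRingEnd ℂ) (F z m))
    (x₀ : ℝ) (hx₀ : (x₀ : ℂ) ∈ 𝒰)
    (k : ℕ) (hk : 1 ≤ k)
    (G : ℂ → Fin 4 → ℂ) (hG : DifferentiableOn ℂ G 𝒰)
    (hfact : ∀ z ∈ 𝒰, F z = (z - (x₀ : ℂ)) ^ k • G z)
    (hG0 : G (x₀ : ℂ) ≠ 0) :
    ∃ V : Set ℂ, IsOpen V ∧ (x₀ : ℂ) ∈ V ∧
      ∃ h : ℂ → ℂ, DifferentiableOn ℂ h V ∧ h (x₀ : ℂ) ≠ 0 ∧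
        ∀ z ∈ V, Phi (F z) = (z - (x₀ : ℂ)) ^ (2 * k) * h z := by
  have him : ∀ m, (G (x₀ : ℂ) m).im = 0 := by
    intro m
    refine im_eq_zero_of_eventually_im_pow_mul_eq_zero (g := fun z => G z m) k ?_ ?_
    · exact continuousAt_pi.mp (hG.differentiableAt (hopen.mem_nhds hx₀)).continuousAt m
    · filter_upwards [Complex.continuous_ofReal.continuousAt.preimage_mem_nhds
        (hopen.mem_nhds hx₀)] with x hx
      have hreal := congrFun (hFsym x hx) m
      rw [Complex.conj_ofReal, hfact x hx] at hreal
      exact Complex.conj_eq_iff_im.mp hreal.symm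
  have hGm := differentiableOn_pi.mp hG
  refine ⟨𝒰, hopen, hx₀, fun z => Phi (G z), ?_, Phi_ne_zero_of_im_eq_zero him hG0, ?_⟩
  · exact ((((hGm 0).pow 2).add ((hGm 1).pow 2)).add ((hGm 2).pow 2)).add ((hGm 3).pow 2)
  · intro z hz
    rw [hfact z hz]
    simp only [Phi, Pi.smul_apply, smul_eq_mul]
    ring
end
end

section
/- Cauchy formula for slice-regular functions (on a disc): let 0 < R < R', let 𝒰 ⊆ ℂ be the open disc {|z| < R'}, and let F : 𝒰 → ℂ⁴ be holomorphic with F(conj z) = conj(F(z)) componentwise, with induced slice-regular function f. Then for every q ∈ ℍ with ‖q‖ < R and every v ∈ 𝕊, f(q) = (1/(2π)) ∫₀^{2π} −( q² − 2R cos θ · q + R² )⁻¹ · ( q − R cos θ + R sin θ · v ) · ( R cos θ + R sin θ · v ) · f( R cos θ + v R sin θ ) dθ, where all products and the inverse are taken in ℍ (the quaternion q² − 2R cos θ · q + R² is invertible for every θ since ‖q‖ < R). -/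
noncomputable section
open Complex MeasureTheory

/-- The real part, with respect to a unit `v`, of the complexified slice Cauchy kernel. -/
def kernelRe (R : ℝ) (G : ℂ → ℂ) (z : ℂ) (θ : ℝ) : ℂ :=
  -((z ^ 2 - (2 * R * Real.cos θ : ℝ) * z + (R ^ 2 : ℝ))⁻¹ *
    ((z - (R * Real.cos θ : ℝ)) * (circleMap 0 R θ * G (circleMap 0 R θ)).re -
      (R * Real.sin θ : ℝ) * (circleMap 0 R θ * G (circleMap 0 R θ)).im))

/-- The imaginary part, with respect to a unit `v`, of the complexified slice Cauchy kernel. -/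
def kernelIm (R : ℝ) (G : ℂ → ℂ) (z : ℂ) (θ : ℝ) : ℂ :=
  -((z ^ 2 - (2 * R * Real.cos θ : ℝ) * z + (R ^ 2 : ℝ))⁻¹ *
    ((z - (R * Real.cos θ : ℝ)) * (circleMap 0 R θ * G (circleMap 0 R θ)).im +
      (R * Real.sin θ : ℝ) * (circleMap 0 R θ * G (circleMap 0 R θ)).re))

lemma circleMap_zero_eq (R θ : ℝ) :
    circleMap 0 R θ = (R * Real.cos θ : ℝ) + (R * Real.sin θ : ℝ) * I := by
  rw [circleMap_zero, Complex.exp_mul_I]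
  push_cast
  ring

lemma conj_circleMap_zero_eq (R θ : ℝ) :
    (starRingEnd ℂ) (circleMap 0 R θ) = (R * Real.cos θ : ℝ) - (R * Real.sin θ : ℝ) * I := by
  rw [circleMap_zero_eq, map_add, map_mul, conj_ofReal, conj_ofReal, conj_I]
  ring

lemma quadratic_eq_mul (R θ : ℝ) (z : ℂ) :
    z ^ 2 - (2 * R * Real.cos θ : ℝ) * z + (R ^ 2 : ℝ) =
      (z - circleMap 0 R θ) * (z - (starRingEnd ℂ) (circleMap 0 R θ)) := by
  have h : ((Real.cos θ : ℝ) : ℂ) ^ 2 + ((Real.sin θ : ℝ) : ℂ) ^ 2 = 1 := by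
    exact_mod_cast Real.cos_sq_add_sin_sq θ
  rw [conj_circleMap_zero_eq, circleMap_zero_eq]
  push_cast at h ⊢
  linear_combination (-(R : ℂ) ^ 2) * h + (R : ℂ) ^ 2 * Complex.sin θ ^ 2 * I_sq

lemma sub_circleMap_ne_zero {R : ℝ} {z : ℂ} (hz : ‖z‖ < R) (θ : ℝ) :
    z - circleMap 0 R θ ≠ 0 ∧ z - (starRingEnd ℂ) (circleMap 0 R θ) ≠ 0 := by
  have hn : ‖circleMap 0 R θ‖ = R := by
    rw [norm_circleMap_zero, abs_of_pos ((norm_nonneg z).trans_lt hz)]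
  constructor
  · intro h
    rw [sub_eq_zero.1 h, hn] at hz
    exact lt_irrefl _ hz
  · intro h
    rw [sub_eq_zero.1 h, RCLike.norm_conj, hn] at hz
    exact lt_irrefl _ hz

lemma continuous_comp_circleMap {R R' : ℝ} (hR : 0 < R) (hRR' : R < R') {G : ℂ → ℂ}
    (hG : DifferentiableOn ℂ G (Metric.ball (0 : ℂ) R')) :
    Continuous fun θ => G (circleMap 0 R θ) := by
  refine hG.continuousOn.comp_continuous (continuous_circleMap 0 R) fun θ => ?_
  rwa [mem_ball_zero_iff, norm_circleMap_zero, abs_of_pos hR]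

lemma continuous_inv_quadratic {R : ℝ} {z : ℂ} (hz : ‖z‖ < R) :
    Continuous fun θ : ℝ => (z ^ 2 - (2 * R * Real.cos θ : ℝ) * z + (R ^ 2 : ℝ))⁻¹ := by
  refine Continuous.inv₀ (by fun_prop) fun θ => ?_
  rw [quadratic_eq_mul]
  exact mul_ne_zero (sub_circleMap_ne_zero hz θ).1 (sub_circleMap_ne_zero hz θ).2

lemma continuous_kernelRe {R R' : ℝ} (hR : 0 < R) (hRR' : R < R') {G : ℂ → ℂ}
    (hG : DifferentiableOn ℂ G (Metric.ball (0 : ℂ) R')) {z : ℂ} (hz : ‖z‖ < R) :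
    Continuous (kernelRe R G z) := by
  have h1 := continuous_comp_circleMap hR hRR' hG
  have h2 := continuous_inv_quadratic hz
  have h3 := (continuous_circleMap 0 R).mul h1
  have h4 := continuous_ofReal.comp (continuous_re.comp h3)
  have h5 := continuous_ofReal.comp (continuous_im.comp h3)
  have h6 : Continuous fun θ : ℝ => z - (R * Real.cos θ : ℝ) := by fun_prop
  have h7 : Continuous fun θ : ℝ => ((R * Real.sin θ : ℝ) : ℂ) := by fun_prop
  unfold kernelRe
  exact (h2.mul ((h6.mul h4).sub (h7.mul h5))).neg

lemma continuous_kernelIm {R R' : ℝ} (hR : 0 < R) (hRR' : R < R') {G : ℂ → ℂ}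
    (hG : DifferentiableOn ℂ G (Metric.ball (0 : ℂ) R')) {z : ℂ} (hz : ‖z‖ < R) :
    Continuous (kernelIm R G z) := by
  have h1 := continuous_comp_circleMap hR hRR' hG
  have h2 := continuous_inv_quadratic hz
  have h3 := (continuous_circleMap 0 R).mul h1
  have h4 := continuous_ofReal.comp (continuous_re.comp h3)
  have h5 := continuous_ofReal.comp (continuous_im.comp h3)
  have h6 : Continuous fun θ : ℝ => z - (R * Real.cos θ : ℝ) := by fun_prop
  have h7 : Continuous fun θ : ℝ => ((R * Real.sin θ : ℝ) : ℂ) := by fun_prop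
  unfold kernelIm
  exact (h2.mul ((h6.mul h5).add (h7.mul h4))).neg

lemma integral_kernelIm {R R' : ℝ} (hR : 0 < R) (hRR' : R < R') {G : ℂ → ℂ}
    (hsym : ∀ z ∈ Metric.ball (0 : ℂ) R', G ((starRingEnd ℂ) z) = (starRingEnd ℂ) (G z)) (z : ℂ) :
    ∫ θ in (0 : ℝ)..(2 * Real.pi), kernelIm R G z θ = 0 := by
  have hodd : ∀ θ, kernelIm R G z (2 * Real.pi - θ) = -kernelIm R G z θ := by
    intro θ
    have hc : circleMap 0 R (2 * Real.pi - θ) = (starRingEnd ℂ) (circleMap 0 R θ) := by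
      rw [conj_circleMap_zero_eq, circleMap_zero_eq, Real.cos_two_pi_sub, Real.sin_two_pi_sub]
      push_cast
      ring
    have hm : circleMap 0 R θ ∈ Metric.ball (0 : ℂ) R' := by
      rwa [mem_ball_zero_iff, norm_circleMap_zero, abs_of_pos hR]
    simp only [kernelIm, hc, hsym _ hm, ← map_mul, conj_re, conj_im, Real.cos_two_pi_sub,
      Real.sin_two_pi_sub]
    push_cast
    ring
  have h := intervalIntegral.integral_comp_sub_left (a := 0) (b := 2 * Real.pi)
    (kernelIm R G z) (2 * Real.pi)
  simp only [hodd, sub_self, sub_zero, intervalIntegral.integral_neg] at h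
  exact self_eq_neg.1 h.symm

lemma integral_kernelRe {R R' : ℝ} (hR : 0 < R) (hRR' : R < R') {G : ℂ → ℂ}
    (hG : DifferentiableOn ℂ G (Metric.ball (0 : ℂ) R'))
    (hsym : ∀ z ∈ Metric.ball (0 : ℂ) R', G ((starRingEnd ℂ) z) = (starRingEnd ℂ) (G z))
    {z : ℂ} (hz : ‖z‖ < R) :
    ∫ θ in (0 : ℝ)..(2 * Real.pi), kernelRe R G z θ = 2 * Real.pi * G z := by
  have hcauchy := (hG.diffContOnCl_ball
    (Metric.closedBall_subset_ball hRR')).circleIntegral_sub_inv_smul (mem_ball_zero_iff.2 hz)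
  have hpt : ∀ θ : ℝ, deriv (circleMap 0 R) θ •
      ((circleMap 0 R θ - z)⁻¹ • G (circleMap 0 R θ)) =
        I * (kernelRe R G z θ + I * kernelIm R G z θ) := by
    intro θ
    obtain ⟨h1, h2⟩ := sub_circleMap_ne_zero hz θ
    have h1' : circleMap 0 R θ - z ≠ 0 := by rwa [← neg_ne_zero, neg_sub]
    have hH := re_add_im (circleMap 0 R θ * G (circleMap 0 R θ))
    have hk : kernelRe R G z θ + I * kernelIm R G z θ =
        -((z - circleMap 0 R θ) * (z - (starRingEnd ℂ) (circleMap 0 R θ)))⁻¹ *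
          ((z - (starRingEnd ℂ) (circleMap 0 R θ)) *
            (circleMap 0 R θ * G (circleMap 0 R θ))) := by
      rw [kernelRe, kernelIm, quadratic_eq_mul, conj_circleMap_zero_eq]
      linear_combination ((z - circleMap 0 R θ) *
        (z - ((R * Real.cos θ : ℝ) - (R * Real.sin θ : ℝ) * I)))⁻¹ * (
          (R * Real.sin θ : ℝ) * (circleMap 0 R θ * G (circleMap 0 R θ)).im * I_sq -
          (z - ((R * Real.cos θ : ℝ) - (R * Real.sin θ : ℝ) * I)) * hH)
    rw [hk, deriv_circleMap, smul_eq_mul, smul_eq_mul]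
    field_simp
    ring
  rw [circleIntegral] at hcauchy
  simp only [hpt] at hcauchy
  rw [intervalIntegral.integral_const_mul, intervalIntegral.integral_add
    ((continuous_kernelRe hR hRR' hG hz).intervalIntegrable _ _)
    (((continuous_kernelIm hR hRR' hG hz).intervalIntegrable _ _).const_mul _),
    intervalIntegral.integral_const_mul, integral_kernelIm hR hRR' hsym, mul_zero, add_zero,
    smul_eq_mul] at hcauchy
  refine mul_left_cancel₀ I_ne_zero (hcauchy.trans ?_)
  ring

/-- `rhoC v` as an algebra homomorphism. -/
def rhoCHom (v : Quaternion ℝ) (hv : v ^ 2 = -1) : ℂ →ₐ[ℝ] Quaternion ℝ :=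
  Complex.liftAux v (by rw [← sq, hv])

lemma rhoCHom_apply (v : Quaternion ℝ) (hv : v ^ 2 = -1) (z : ℂ) :
    rhoCHom v hv z = rhoC v z := by
  rw [rhoCHom, Complex.liftAux_apply]
  rfl

/-- `rhoC v` as a continuous linear map. -/
def rhoCL (v : Quaternion ℝ) (hv : v ^ 2 = -1) : ℂ →L[ℝ] Quaternion ℝ :=
  LinearMap.toContinuousLinearMap (rhoCHom v hv).toLinearMap

lemma rhoCL_apply (v : Quaternion ℝ) (hv : v ^ 2 = -1) (z : ℂ) :
    rhoCL v hv z = rhoC v z :=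
  rhoCHom_apply v hv z

lemma norm_rhoC {w : Quaternion ℝ} (hw : w ^ 2 = -1) (z : ℂ) : ‖rhoC w z‖ = ‖z‖ := by
  have h0 : (w ^ 2).re = (-1 : Quaternion ℝ).re := by rw [hw]
  have h1 : (w ^ 2).imI = (-1 : Quaternion ℝ).imI := by rw [hw]
  have h2 : (w ^ 2).imJ = (-1 : Quaternion ℝ).imJ := by rw [hw]
  have h3 : (w ^ 2).imK = (-1 : Quaternion ℝ).imK := by rw [hw]
  simp only [sq, Quaternion.re_mul, Quaternion.imI_mul, Quaternion.imJ_mul, Quaternion.imK_mul,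
    Quaternion.re_neg, Quaternion.imI_neg, Quaternion.imJ_neg, Quaternion.imK_neg,
    Quaternion.re_one, Quaternion.imI_one, Quaternion.imJ_one, Quaternion.imK_one]
    at h0 h1 h2 h3
  have hre : w.re = 0 := by
    by_contra hne
    have e1 : w.imI = 0 := by
      apply mul_left_cancel₀ hne; linarith
    have e2 : w.imJ = 0 := by
      apply mul_left_cancel₀ hne; linarith
    have e3 : w.imK = 0 := by
      apply mul_left_cancel₀ hne; linarith
    rw [e1, e2, e3] at h0
    nlinarith
  rw [← sq_eq_sq₀ (norm_nonneg _) (norm_nonneg _), Complex.sq_norm, Complex.normSq_apply,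
    sq, ← Quaternion.normSq_eq_norm_mul_self, Quaternion.normSq_def']
  rw [hre] at h0
  simp [rhoC, hre]
  linear_combination (-z.im ^ 2) * h0

lemma sliceCauchy_integrand_eq (R : ℝ) (G : ℂ → ℂ) {v w : Quaternion ℝ}
    (hv : v ^ 2 = -1) (hw : w ^ 2 = -1) (z : ℂ) (θ : ℝ) :
    -(((rhoC w z) ^ 2 - (2 * R * Real.cos θ) • rhoC w z + ((R ^ 2 : ℝ) : Quaternion ℝ))⁻¹ *
      (rhoC w z - ((R * Real.cos θ : ℝ) : Quaternion ℝ) + (R * Real.sin θ) • v) *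
      (((R * Real.cos θ : ℝ) : Quaternion ℝ) + (R * Real.sin θ) • v) *
      rhoC v (G (((R * Real.cos θ : ℝ) : ℂ) + ((R * Real.sin θ : ℝ) : ℂ) * Complex.I))) =
    rhoC w (kernelRe R G z θ) + rhoC w (kernelIm R G z θ) * v := by
  have hvv : v * v = -1 := by rw [← sq, hv]
  have hreal : ∀ r : ℝ, rhoCHom w hw (r : ℂ) = (r : Quaternion ℝ) := by
    intro r
    rw [rhoCHom_apply]
    simp [rhoC]
  have hs : ((R * Real.cos θ : ℝ) : Quaternion ℝ) + (R * Real.sin θ) • v =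
      rhoCHom v hv (circleMap 0 R θ) := by
    rw [rhoCHom_apply, circleMap_zero_eq, rhoC, ← mk_eq_add_mul_I]
  rw [← circleMap_zero_eq, hs, mul_assoc _ (rhoCHom v hv _), ← rhoCHom_apply v hv, ← map_mul,
    rhoCHom_apply v hv, kernelRe, kernelIm, ← rhoCHom_apply w hw, ← rhoCHom_apply w hw,
    ← rhoCHom_apply w hw]
  generalize circleMap 0 R θ * G (circleMap 0 R θ) = h
  simp only [map_neg, map_mul, map_inv₀, map_add, map_sub, map_pow, hreal]
  simp only [rhoC, ← Quaternion.coe_mul_eq_smul]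
  generalize rhoCHom w hw z = p
  generalize ((R * Real.cos θ : ℝ) : Quaternion ℝ) = c
  generalize R * Real.sin θ = t
  have e1 : v * (h.re : Quaternion ℝ) = h.re * v := (Quaternion.coe_commutes _ _).symm
  have e2 : v * (h.im : Quaternion ℝ) = h.im * v := (Quaternion.coe_commutes _ _).symm
  have e3 : (p - c + t * v) * (h.re + h.im * v) =
      ((p - c) * h.re - t * h.im) + ((p - c) * h.im + t * h.re) * v := by
    have e4 : (t * v) * h.re = (t : Quaternion ℝ) * h.re * v := by rw [mul_assoc, e1, mul_assoc]
    have e5 : (t * v) * (h.im * v) = -((t : Quaternion ℝ) * h.im) := by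
      rw [mul_assoc, ← mul_assoc v, e2, mul_assoc _ v v, hvv, mul_neg_one, mul_neg]
    rw [add_mul, mul_add, mul_add, e4, e5, add_mul, mul_assoc (p - c)]
    abel
  rw [mul_assoc _ (p - c + t * v), e3, mul_add, neg_add, neg_mul, mul_assoc _ _ v]

lemma sliceCauchy_component {R R' : ℝ} (hR : 0 < R) (hRR' : R < R') {G : ℂ → ℂ}
    (hG : DifferentiableOn ℂ G (Metric.ball (0 : ℂ) R'))
    (hsym : ∀ z ∈ Metric.ball (0 : ℂ) R', G ((starRingEnd ℂ) z) = (starRingEnd ℂ) (G z))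
    {v w : Quaternion ℝ} (hw : w ^ 2 = -1) {z : ℂ} (hz : ‖z‖ < R)
    (e : Quaternion ℝ) :
    IntervalIntegrable (fun θ => (rhoC w (kernelRe R G z θ) + rhoC w (kernelIm R G z θ) * v) * e)
      volume 0 (2 * Real.pi) ∧
    ∫ θ in (0 : ℝ)..(2 * Real.pi),
      (rhoC w (kernelRe R G z θ) + rhoC w (kernelIm R G z θ) * v) * e =
        (2 * Real.pi) • (rhoC w (G z) * e) := by
  have hRe := continuous_kernelRe hR hRR' hG hz
  have hIm := continuous_kernelIm hR hRR' hG hz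
  let A : ℂ →L[ℝ] Quaternion ℝ := ((ContinuousLinearMap.mul ℝ (Quaternion ℝ)).flip e).comp
    (rhoCL w hw)
  let B : ℂ →L[ℝ] Quaternion ℝ := ((ContinuousLinearMap.mul ℝ (Quaternion ℝ)).flip (v * e)).comp
    (rhoCL w hw)
  have hA : ∀ u, A u = rhoC w u * e := fun u => by simp [A, rhoCL_apply]
  have hB : ∀ u, B u = rhoC w u * (v * e) := fun u => by simp [B, rhoCL_apply]
  have hAB : (fun θ => (rhoC w (kernelRe R G z θ) + rhoC w (kernelIm R G z θ) * v) * e) =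
      fun θ => A (kernelRe R G z θ) + B (kernelIm R G z θ) := by
    funext θ
    rw [hA, hB, add_mul, mul_assoc]
  have hAi : IntervalIntegrable (fun θ => A (kernelRe R G z θ)) volume 0 (2 * Real.pi) :=
    (A.continuous.comp hRe).intervalIntegrable _ _
  have hBi : IntervalIntegrable (fun θ => B (kernelIm R G z θ)) volume 0 (2 * Real.pi) :=
    (B.continuous.comp hIm).intervalIntegrable _ _
  rw [hAB]
  refine ⟨hAi.add hBi, ?_⟩
  rw [intervalIntegral.integral_add hAi hBi,
    A.intervalIntegral_comp_comm (hRe.intervalIntegrable _ _),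
    B.intervalIntegral_comp_comm (hIm.intervalIntegrable _ _),
    integral_kernelRe hR hRR' hG hsym hz, integral_kernelIm hR hRR' hsym, map_zero, add_zero,
    ← hA, ← map_smul, Complex.real_smul]
  push_cast
  rfl

/-- Cauchy formula for slice-regular functions on a disc: for `0 < R < R'`,
`F` holomorphic on `{|z| < R'}` with `F(conj z) = conj F(z)`, every `q = x + yw ∈ ℍ` with
`‖q‖ < R` (`w` an imaginary unit) and every imaginary unit `v`,
`f(q) = (1/2π) ∫₀^{2π} −(q² − 2R cos θ q + R²)⁻¹ (q − R cos θ + R sin θ v)(R cos θ + R sin θ v)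
· f(R cos θ + v R sin θ) dθ`, where `f(x+vy) = ρ_v(F(x+ιy))`. -/
theorem stmt_12 (R R' : ℝ) (hR : 0 < R) (hRR' : R < R')
    (F : ℂ → Fin 4 → ℂ)
    (hF : DifferentiableOn ℂ F (Metric.ball (0 : ℂ) R'))
    (hFsym : ∀ z ∈ Metric.ball (0 : ℂ) R',
      F ((starRingEnd ℂ) z) = fun m => (starRingEnd ℂ) (F z m))
    (x y : ℝ) (w : Quaternion ℝ) (hw : w ^ 2 = -1)
    (q : Quaternion ℝ) (hqdef : q = (x : Quaternion ℝ) + y • w) (hq : ‖q‖ < R)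
    (v : Quaternion ℝ) (hv : v ^ 2 = -1) :
    rho4 w (F (x + y * Complex.I)) =
      (1 / (2 * Real.pi)) •
        ∫ θ in (0 : ℝ)..(2 * Real.pi),
          -((q ^ 2 - (2 * R * Real.cos θ) • q + ((R ^ 2 : ℝ) : Quaternion ℝ))⁻¹ *
            (q - ((R * Real.cos θ : ℝ) : Quaternion ℝ) + (R * Real.sin θ) • v) *
            (((R * Real.cos θ : ℝ) : Quaternion ℝ) + (R * Real.sin θ) • v) *
            rho4 v (F (((R * Real.cos θ : ℝ) : ℂ) + ((R * Real.sin θ : ℝ) : ℂ) * Complex.I))) := by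
  have hq' : q = rhoC w (x + y * I) := by simp [hqdef, rhoC]
  have hz : ‖(x + y * I : ℂ)‖ < R := by rwa [← norm_rhoC hw, ← hq']
  have hcomp : ∀ m, DifferentiableOn ℂ (fun z => F z m) (Metric.ball (0 : ℂ) R') :=
    differentiableOn_pi.1 hF
  have hsym : ∀ m, ∀ z ∈ Metric.ball (0 : ℂ) R',
      F ((starRingEnd ℂ) z) m = (starRingEnd ℂ) (F z m) := fun m z hz => congrFun (hFsym z hz) m
  have key := fun m => sliceCauchy_component hR hRR' (hcomp m) (hsym m) (v := v) hw hz
  have hcoord : ∀ m, ∀ θ : ℝ, _ := fun m θ =>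
    sliceCauchy_integrand_eq R (fun z => F z m) hv hw (x + y * I) θ
  subst hq'
  have hfun : ∀ θ : ℝ,
      -(((rhoC w (x + y * I)) ^ 2 - (2 * R * Real.cos θ) • rhoC w (x + y * I) +
          ((R ^ 2 : ℝ) : Quaternion ℝ))⁻¹ *
        (rhoC w (x + y * I) - ((R * Real.cos θ : ℝ) : Quaternion ℝ) + (R * Real.sin θ) • v) *
        (((R * Real.cos θ : ℝ) : Quaternion ℝ) + (R * Real.sin θ) • v) *
        rho4 v (F (((R * Real.cos θ : ℝ) : ℂ) + ((R * Real.sin θ : ℝ) : ℂ) * Complex.I))) =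
      (rhoC w (kernelRe R (fun z => F z 0) (x + y * I) θ) +
        rhoC w (kernelIm R (fun z => F z 0) (x + y * I) θ) * v) * 1 +
      (rhoC w (kernelRe R (fun z => F z 1) (x + y * I) θ) +
        rhoC w (kernelIm R (fun z => F z 1) (x + y * I) θ) * v) * qi +
      (rhoC w (kernelRe R (fun z => F z 2) (x + y * I) θ) +
        rhoC w (kernelIm R (fun z => F z 2) (x + y * I) θ) * v) * qj +
      (rhoC w (kernelRe R (fun z => F z 3) (x + y * I) θ) +
        rhoC w (kernelIm R (fun z => F z 3) (x + y * I) θ) * v) * qk := by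
    intro θ
    rw [← hcoord 0, ← hcoord 1, ← hcoord 2, ← hcoord 3, rho4]
    noncomm_ring
  simp only [hfun]
  rw [intervalIntegral.integral_add (((key 0 1).1.add (key 1 qi).1).add (key 2 qj).1) (key 3 qk).1,
    intervalIntegral.integral_add ((key 0 1).1.add (key 1 qi).1) (key 2 qj).1,
    intervalIntegral.integral_add (key 0 1).1 (key 1 qi).1,
    (key 0 1).2, (key 1 qi).2, (key 2 qj).2, (key 3 qk).2, ← smul_add, ← smul_add, ← smul_add,
    smul_smul, one_div_mul_cancel Real.two_pi_pos.ne', one_smul, mul_one, rho4]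
end
end

section
/- Let z, w ∈ ℂ⁴ and suppose that there exists v ∈ 𝕊 with ρ_v(z) = 0, or there exists v ∈ 𝕊 with ρ_v(w) = 0. Then there exists u ∈ 𝕊 with ρ_u(z ⋆ w) = 0. (Consequently, if one of two slice-regular functions f, g has a zero on a sphere x + 𝕊y, then their ⋆-product f ⋆ g also has a zero on that sphere.) -/
noncomputable section
open Complex MeasureTheory

/-- The `⋆`-product on `ℂ⁴ ≅ ℍ ⊗_ℝ ℂ`: the `ℂ`-bilinear product in which the basis
`1, i, j, k` multiplies as in the quaternions. -/
def starMul (z w : Fin 4 → ℂ) : Fin 4 → ℂ :=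
  ![z 0 * w 0 - z 1 * w 1 - z 2 * w 2 - z 3 * w 3,
    z 0 * w 1 + z 1 * w 0 + z 2 * w 3 - z 3 * w 2,
    z 0 * w 2 - z 1 * w 3 + z 2 * w 0 + z 3 * w 1,
    z 0 * w 3 + z 1 * w 2 - z 2 * w 1 + z 3 * w 0]

/-- The quaternion whose coordinates are the real parts of those of `z`. -/
def quatRe (z : Fin 4 → ℂ) : Quaternion ℝ := ⟨(z 0).re, (z 1).re, (z 2).re, (z 3).re⟩

/-- The quaternion whose coordinates are the imaginary parts of those of `z`. -/
def quatIm (z : Fin 4 → ℂ) : Quaternion ℝ := ⟨(z 0).im, (z 1).im, (z 2).im, (z 3).im⟩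

theorem rho4_eq (v : Quaternion ℝ) (z : Fin 4 → ℂ) : rho4 v z = quatRe z + v * quatIm z := by
  ext <;> simp [rho4, rhoC] <;> simp [quatRe, quatIm, qi, qj, qk] <;> ring

theorem quatRe_starMul (z w : Fin 4 → ℂ) :
    quatRe (starMul z w) = quatRe z * quatRe w - quatIm z * quatIm w := by
  ext <;> simp <;> simp [starMul, quatRe, quatIm] <;> ring

theorem quatIm_starMul (z w : Fin 4 → ℂ) :
    quatIm (starMul z w) = quatRe z * quatIm w + quatIm z * quatRe w := by
  ext <;> simp <;> simp [starMul, quatRe, quatIm] <;> ring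

/-- A zero of the left factor is a zero of the `⋆`-product. -/
theorem rho4_starMul_eq_zero_of_left {v : Quaternion ℝ} (hv : v ^ 2 = -1) {z : Fin 4 → ℂ}
    (hz : rho4 v z = 0) (w : Fin 4 → ℂ) : rho4 v (starMul z w) = 0 := by
  rw [rho4_eq] at hz
  rw [rho4_eq, quatRe_starMul, quatIm_starMul, eq_neg_of_add_eq_zero_left hz]
  generalize quatRe w = c, quatIm w = d, quatIm z = b
  calc -(v * b) * c - b * d + v * (-(v * b) * d + b * c)
      = -(b * d) - v ^ 2 * (b * d) := by noncomm_ring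
    _ = 0 := by rw [hv]; noncomm_ring

/-- A zero `v` of the right factor gives the zero `q v q⁻¹` of the `⋆`-product, where
`q = Re z * v + Im z`; if `q = 0`, every imaginary unit is a zero. -/
theorem exists_rho4_starMul_eq_zero_of_right {v : Quaternion ℝ} (hv : v ^ 2 = -1)
    (z : Fin 4 → ℂ) {w : Fin 4 → ℂ} (hw : rho4 v w = 0) :
    ∃ u : Quaternion ℝ, u ^ 2 = -1 ∧ rho4 u (starMul z w) = 0 := by
  rw [rho4_eq] at hw
  have key (u : Quaternion ℝ) : rho4 u (starMul z w) =
      -((quatRe z * v + quatIm z) + u * (quatRe z * v + quatIm z) * v) * quatIm w := by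
    rw [rho4_eq, quatRe_starMul, quatIm_starMul, eq_neg_of_add_eq_zero_left hw]
    generalize quatRe z = a, quatIm w = d, quatIm z = b
    calc a * -(v * d) - b * d + u * (a * d + b * -(v * d))
        = -(a * v + b + u * b * v) * d - u * a * (-1) * d := by noncomm_ring
      _ = -(a * v + b + u * (a * v + b) * v) * d := by rw [← hv]; noncomm_ring
  simp only [key]
  generalize quatRe z * v + quatIm z = q
  by_cases hq : q = 0
  · exact ⟨v, hv, by simp [hq]⟩
  · refine ⟨q * v * q⁻¹, ?_, ?_⟩
    · calc (q * v * q⁻¹) ^ 2 = q * v * (q⁻¹ * q) * v * q⁻¹ := by simp only [pow_two, mul_assoc]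
        _ = q * v ^ 2 * q⁻¹ := by rw [inv_mul_cancel₀ hq]; simp only [pow_two, mul_assoc, one_mul]
        _ = -1 := by simp [hv, hq]
    · have : q * v * q⁻¹ * q * v = -q := by
        rw [inv_mul_cancel_right₀ hq, mul_assoc, ← pow_two, hv, mul_neg_one]
      simp [this]

/-- if `ρ_v(z) = 0` for some imaginary unit `v`, or `ρ_v(w) = 0` for some
imaginary unit `v`, then `ρ_u(z ⋆ w) = 0` for some imaginary unit `u`. -/
theorem stmt_13 (z w : Fin 4 → ℂ)
    (h : (∃ v : Quaternion ℝ, v ^ 2 = -1 ∧ rho4 v z = 0) ∨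
         (∃ v : Quaternion ℝ, v ^ 2 = -1 ∧ rho4 v w = 0)) :
    ∃ u : Quaternion ℝ, u ^ 2 = -1 ∧ rho4 u (starMul z w) = 0 := by
  rcases h with ⟨v, hv, hz⟩ | ⟨v, hv, hw⟩
  · exact ⟨v, hv, rho4_starMul_eq_zero_of_left hv hz w⟩
  · exact exists_rho4_starMul_eq_zero_of_right hv z hw
end
end

section
/- For all quaternions a, b ∈ ℍ there exist v₁, v₂ ∈ 𝕊 such that ‖a + v₁ b‖² ≤ ‖a‖² + ‖b‖² ≤ ‖a + v₂ b‖². (Hence for a slice-regular function f with stem map F, min_{v∈𝕊} ‖f(x+vy)‖ ≤ ‖F(x+ιy)‖ ≤ max_{v∈𝕊} ‖f(x+vy)‖, where ℂ⁴ carries the Euclidean norm.) -/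
noncomputable section

/-- For a unit quaternion `v`, the squared norms `‖a ± v * b‖ ^ 2` average to
`‖a‖ ^ 2 + ‖b‖ ^ 2`. -/
theorem Quaternion.norm_add_mul_sq_add_norm_add_neg_mul_sq (a b : Quaternion ℝ)
    {v : Quaternion ℝ} (hv : ‖v‖ = 1) :
    ‖a + v * b‖ ^ 2 + ‖a + -v * b‖ ^ 2 = 2 * (‖a‖ ^ 2 + ‖b‖ ^ 2) := by
  have h := parallelogram_law_with_norm ℝ a (v * b)
  rw [norm_mul, hv, one_mul] at h
  rw [neg_mul, ← sub_eq_add_neg]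
  linarith

/-- for all quaternions `a, b` there are imaginary units `v₁, v₂` with
`‖a + v₁ b‖² ≤ ‖a‖² + ‖b‖² ≤ ‖a + v₂ b‖²`. -/
theorem stmt_14 (a b : Quaternion ℝ) :
    ∃ v₁ v₂ : Quaternion ℝ, v₁ ^ 2 = -1 ∧ v₂ ^ 2 = -1 ∧
      ‖a + v₁ * b‖ ^ 2 ≤ ‖a‖ ^ 2 + ‖b‖ ^ 2 ∧
      ‖a‖ ^ 2 + ‖b‖ ^ 2 ≤ ‖a + v₂ * b‖ ^ 2 := by
  obtain ⟨v, hv⟩ : ∃ v : Quaternion ℝ, v ^ 2 = -1 :=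
    ⟨(Complex.I : Quaternion ℝ), by
      rw [sq, ← Quaternion.coeComplex_mul, Complex.I_mul_I]; ext <;> simp [Quaternion.re_one, Quaternion.imI_one, Quaternion.imJ_one,
        Quaternion.imK_one]⟩
  have hv' : (-v) ^ 2 = -1 := by rw [neg_sq, hv]
  have hn : ‖v‖ = 1 := by
    have h : ‖v‖ ^ 2 = 1 := by rw [← norm_pow, hv, norm_neg, norm_one]
    exact (pow_eq_one_iff_of_nonneg (norm_nonneg v) two_ne_zero).1 h
  have h := Quaternion.norm_add_mul_sq_add_norm_add_neg_mul_sq a b hn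
  rcases le_total (‖a + v * b‖ ^ 2) (‖a‖ ^ 2 + ‖b‖ ^ 2) with hle | hle
  · exact ⟨v, -v, hv, hv', hle, by linarith⟩
  · exact ⟨-v, v, hv', hv, by linarith, hle⟩
end
end

section
/- For all quaternions a, b ∈ ℍ, ∫_{S²} ‖a + (x₁ i + x₂ j + x₃ k)·b‖² dσ(x) = 4π (‖a‖² + ‖b‖²), where the integral is taken over the unit sphere S² ⊂ ℝ³ with respect to its surface measure σ. (Consequently, for a slice-regular function f with stem map F, ∫_𝕊 ‖f(x+v'y)‖² dσ(v') = 4π ‖F(x+ιy)‖².) -/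
noncomputable section
open MeasureTheory

lemma measurePreserving_neg_toSphere {E : Type*} [NormedAddCommGroup E] [NormedSpace ℝ E]
    [MeasurableSpace E] [BorelSpace E] (μ : Measure E) [μ.IsNegInvariant] :
    MeasurePreserving (Neg.neg : Metric.sphere (0 : E) 1 → Metric.sphere (0 : E) 1)
      μ.toSphere μ.toSphere := by
  have hm : Measurable (Neg.neg : Metric.sphere (0 : E) 1 → Metric.sphere (0 : E) 1) :=
    continuous_neg.measurable
  refine ⟨hm, Measure.ext fun s hs => ?_⟩
  rw [Measure.map_apply hm hs, μ.toSphere_apply' hs, μ.toSphere_apply' (hm hs)]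
  have hcoe : ((↑) '' (Neg.neg ⁻¹' s) : Set E) = -((↑) '' s) := by
    ext x
    simp only [Set.mem_image, Set.mem_preimage, Set.mem_neg]
    constructor
    · rintro ⟨y, hy, rfl⟩
      exact ⟨-y, hy, rfl⟩
    · rintro ⟨y, hy, h⟩
      exact ⟨-y, by rwa [neg_neg], by rw [coe_neg_sphere, h, neg_neg]⟩
  rw [hcoe, Set.smul_neg, Measure.measure_neg]

lemma integral_neg_toSphere {E F : Type*} [NormedAddCommGroup E] [NormedSpace ℝ E]
    [MeasurableSpace E] [BorelSpace E] [NormedAddCommGroup F] [NormedSpace ℝ F]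
    (μ : Measure E) [μ.IsNegInvariant] (f : Metric.sphere (0 : E) 1 → F) :
    ∫ x, f (-x) ∂μ.toSphere = ∫ x, f x ∂μ.toSphere :=
  (measurePreserving_neg_toSphere μ).integral_comp
    (Homeomorph.neg (Metric.sphere (0 : E) 1)).measurableEmbedding f

lemma norm_smul_qi_add_smul_qj_add_smul_qk (x : EuclideanSpace ℝ (Fin 3)) :
    ‖x 0 • qi + x 1 • qj + x 2 • qk‖ = ‖x‖ := by
  rw [← sq_eq_sq₀ (norm_nonneg _) (norm_nonneg _), EuclideanSpace.real_norm_sq_eq, sq,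
    ← Quaternion.normSq_eq_norm_mul_self, Quaternion.normSq_def', Fin.sum_univ_three]
  simp only [Quaternion.re_add, Quaternion.imI_add, Quaternion.imJ_add, Quaternion.imK_add,
    Quaternion.re_smul, Quaternion.imI_smul, Quaternion.imJ_smul, Quaternion.imK_smul]
  simp [qi, qj, qk]

lemma toSphere_volume_real_univ_fin_three :
    (volume : Measure (EuclideanSpace ℝ (Fin 3))).toSphere.real Set.univ = 4 * Real.pi := by
  rw [Measure.toSphere_real_apply_univ, measureReal_def, EuclideanSpace.volume_ball_fin_three,
    finrank_euclideanSpace_fin, ENNReal.ofReal_one, one_pow, one_mul,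
    ENNReal.toReal_ofReal (by positivity)]
  push_cast
  ring

/-- for all quaternions `a, b`,
`∫_{S²} ‖a + (x₁ i + x₂ j + x₃ k) b‖² dσ(x) = 4π (‖a‖² + ‖b‖²)`, where `σ` is the surface
measure on the unit sphere of `ℝ³` (of total mass `4π`). -/
theorem stmt_18 (a b : Quaternion ℝ) :
    ∫ x : Metric.sphere (0 : EuclideanSpace ℝ (Fin 3)) 1,
        ‖a + (x.1 0 • qi + x.1 1 • qj + x.1 2 • qk) * b‖ ^ 2
        ∂((volume : Measure (EuclideanSpace ℝ (Fin 3))).toSphere)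
      = 4 * Real.pi * (‖a‖ ^ 2 + ‖b‖ ^ 2) := by
  set μ := (volume : Measure (EuclideanSpace ℝ (Fin 3))).toSphere with hμ
  set f : Metric.sphere (0 : EuclideanSpace ℝ (Fin 3)) 1 → ℝ := fun x =>
    ‖a + (x.1 0 • qi + x.1 1 • qj + x.1 2 • qk) * b‖ ^ 2 with hf
  have hcont : Continuous f := by fun_prop
  have hint : ∀ {g : Metric.sphere (0 : EuclideanSpace ℝ (Fin 3)) 1 → ℝ},
      Continuous g → Integrable g μ := fun hg =>
    hg.integrable_of_hasCompactSupport (HasCompactSupport.of_compactSpace _)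
  have hpar : ∀ x, f x + f (-x) = 2 * (‖a‖ ^ 2 + ‖b‖ ^ 2) := fun x => by
    have hx : ‖(x.1 0 • qi + x.1 1 • qj + x.1 2 • qk) * b‖ = ‖b‖ := by
      rw [norm_mul, norm_smul_qi_add_smul_qj_add_smul_qk, norm_eq_of_mem_sphere x, one_mul]
    have hneg : f (-x) = ‖a - (x.1 0 • qi + x.1 1 • qj + x.1 2 • qk) * b‖ ^ 2 := by
      simp only [hf, coe_neg_sphere, PiLp.neg_apply, neg_smul, sub_eq_add_neg, ← neg_add, neg_mul]
    have h := parallelogram_law_with_norm ℝ a ((x.1 0 • qi + x.1 1 • qj + x.1 2 • qk) * b)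
    rw [hx] at h
    rw [hneg]
    linarith
  have hsum : ∫ x, f x ∂μ + ∫ x, f (-x) ∂μ = 4 * Real.pi * (2 * (‖a‖ ^ 2 + ‖b‖ ^ 2)) := by
    rw [← integral_add (hint hcont) (hint (g := fun x => f (-x)) (hcont.comp continuous_neg))]
    simp only [hpar, integral_const, smul_eq_mul, hμ, toSphere_volume_real_univ_fin_three]
  rw [hμ, integral_neg_toSphere, ← hμ] at hsum
  linarith
end
end
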